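/- For every natural number n, there do not exist an injective function f : ℝ → ℝ^n and a linear map K : ℝ^n → ℝ^n such that f(cos(t+1)) = K(f(cos t)) for all t ∈ ℝ. -/

import Mathlib

/-- The signal `x_t = cos(t)` cannot be lifted to a linear evolution by an injective
observable function: for every `n`, there is no injective `f : ℝ → ℝ^n` and linear map
`K : ℝ^n → ℝ^n` with `f(cos(t+1)) = K(f(cos t))` for all real `t`. -/
theorem cos_not_liftable_by_injective_function
    (n : ℕ) :
    ¬ ∃ (f : ℝ → (Fin n → ℝ)) (K : (Fin n → ℝ) →ₗ[ℝ] (Fin n → ℝ)),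
        Function.Injective f ∧
        ∀ t : ℝ, f (Real.cos (t + 1)) = K (f (Real.cos t)) := by
  rintro ⟨f, K, hf, hK⟩
  have h : f (Real.cos (Real.pi / 2 + 1)) = f (Real.cos (-(Real.pi / 2) + 1)) := by
    rw [hK, hK, Real.cos_neg]
  have h_cos := hf h
  simp only [Real.cos_add, Real.cos_neg, Real.sin_neg, Real.cos_pi_div_two,
    Real.sin_pi_div_two] at h_cos
  have h_sin : 0 < Real.sin 1 :=
    Real.sin_pos_of_pos_of_lt_pi one_pos (by linarith [Real.pi_gt_three])
  linarith
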